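/- arXiv:1711.07016 — 3 statements merged into one kernel-verified Lean document; each statement's English description precedes it below -/
import Mathlib

section
/- Let r ∈ (0,1/2), ν ∈ (0,1], λ > 0 and t > 0 be real numbers, and let C(s) = ∑_{k=0}^∞ (Γ(ν+k))^r λ^k s^k / k! for s > 0. Then (1/Γ(r)) ∫_0^t (ln(t/τ))^{r−1} τ^{ν−1} C′(τ) dτ = λ t^ν C(t); that is, the function C satisfies the Hadamard-type integro-differential equation 𝒥^r ( t^ν dC/dt ) = λ t^ν C with time-varying coefficient t^ν. -/
open MeasureTheory Set Filter Topology

/-- The power series `∑ Γ(ν+k)^r x^k / k!` converges absolutely everywhere when `r < 1`. -/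
lemma summable_gamma_rpow_mul_pow_div_factorial {r ν : ℝ} (hr1 : r < 1) (hν : 0 < ν) (x : ℝ) :
    Summable fun k : ℕ => Real.Gamma (ν + k) ^ r * x ^ k / (Nat.factorial k : ℝ) := by
  rcases eq_or_ne x 0 with rfl | hx
  · refine summable_of_ne_finset_zero (s := {0}) fun k hk => ?_
    have : k ≠ 0 := by simpa using hk
    simp [this]
  have hΓ (k : ℕ) : 0 < Real.Gamma (ν + k) := Real.Gamma_pos_of_pos (by positivity)
  refine summable_of_ratio_test_tendsto_lt_one (l := 0) one_pos
    (Eventually.of_forall fun k => ?_) ?_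
  · have := (Real.rpow_pos_of_pos (hΓ k) r).ne'
    positivity
  have hratio (k : ℕ) : ‖Real.Gamma (ν + (k + 1 : ℕ)) ^ r * x ^ (k + 1) /
        (Nat.factorial (k + 1) : ℝ)‖ / ‖Real.Gamma (ν + k) ^ r * x ^ k / (Nat.factorial k : ℝ)‖ =
      (ν + k) ^ (r - 1) * ((ν + k) / (k + 1)) * |x| := by
    have h0 : 0 < ν + k := by positivity
    have h1 : Real.Gamma (ν + (k + 1 : ℕ)) = (ν + k) * Real.Gamma (ν + k) := by
      rw [← Real.Gamma_add_one h0.ne']; push_cast; ring_nf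
    have h2 := Real.rpow_pos_of_pos (hΓ k) r
    rw [h1, Real.mul_rpow h0.le (hΓ k).le, Real.rpow_sub_one h0.ne', ← norm_div,
      Nat.factorial_succ]
    have h3 : (0 : ℝ) < (ν + k) ^ r := Real.rpow_pos_of_pos h0 r
    have h4 : (ν + k) ^ r * Real.Gamma (ν + k) ^ r * x ^ (k + 1) /
        (((k + 1) * Nat.factorial k : ℕ) : ℝ) /
          (Real.Gamma (ν + k) ^ r * x ^ k / (Nat.factorial k : ℝ)) =
        (ν + k) ^ r / (k + 1) * x := by
      have := Nat.factorial_pos k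
      push_cast
      rw [pow_succ]
      field_simp
    rw [h4, norm_mul, Real.norm_eq_abs, Real.norm_eq_abs, abs_of_pos (by positivity)]
    field_simp
  simp_rw [hratio]
  have hk : Tendsto (fun k : ℕ => ν + (k : ℝ)) atTop atTop :=
    tendsto_atTop_add_const_left _ _ tendsto_natCast_atTop_atTop
  have hA : Tendsto (fun k : ℕ => (ν + (k : ℝ)) ^ (r - 1)) atTop (𝓝 0) := by
    have := (tendsto_rpow_neg_atTop (y := 1 - r) (by linarith)).comp hk
    simpa [Function.comp_def] using this
  have hB : Tendsto (fun k : ℕ => (ν + (k : ℝ)) / (k + 1)) atTop (𝓝 1) := by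
    have h := (tendsto_one_div_add_atTop_nhds_zero_nat (𝕜 := ℝ)).const_mul (ν - 1) |>.const_add 1
    simp only [mul_zero, add_zero] at h
    refine h.congr fun k => ?_
    field_simp
    ring
  simpa using (hA.mul hB).mul_const |x|

/-- Differentiating the normalizing function shifts `ν` to `ν + 1`. -/
lemma hasDerivAt_tsum_gamma_rpow {r ν lam : ℝ} (hr1 : r < 1) (hν : 0 < ν) (s : ℝ) :
    HasDerivAt
      (fun s : ℝ => ∑' k : ℕ, Real.Gamma (ν + k) ^ r * lam ^ k * s ^ k / (Nat.factorial k : ℝ))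
      (∑' k : ℕ, lam * (Real.Gamma (ν + 1 + k) ^ r * (lam * s) ^ k / (Nat.factorial k : ℝ))) s := by
  set R : ℝ := |s| + 1
  have hsR : s ∈ Metric.ball (0 : ℝ) R := by simp [R]
  set g' : ℕ → ℝ → ℝ := fun k y =>
    Real.Gamma (ν + k) ^ r * lam ^ k * (k * y ^ (k - 1)) / (Nat.factorial k : ℝ)
  have hsucc (k : ℕ) (y : ℝ) : g' (k + 1) y =
      lam * (Real.Gamma (ν + 1 + k) ^ r * (lam * y) ^ k / (Nat.factorial k : ℝ)) := by
    have h1 : ν + ((k + 1 : ℕ) : ℝ) = ν + 1 + k := by push_cast; ring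
    simp only [g', h1, Nat.factorial_succ, Nat.add_sub_cancel, mul_pow, pow_succ]
    have := Nat.factorial_pos k
    push_cast
    field_simp
  have hsum (y : ℝ) : Summable fun k => g' k y := by
    rw [← summable_nat_add_iff 1]
    simp_rw [hsucc]
    exact (summable_gamma_rpow_mul_pow_div_factorial hr1 (by linarith) _).mul_left lam
  have key := hasDerivAt_tsum_of_isPreconnected (u := fun k => ‖g' k R‖)
    (g := fun (k : ℕ) (y : ℝ) =>
      Real.Gamma (ν + k) ^ r * lam ^ k * y ^ k / (Nat.factorial k : ℝ)) (g' := g')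
    (hsum R).norm Metric.isOpen_ball (convex_ball (0 : ℝ) R).isPreconnected
    (fun k y _ => ((hasDerivAt_pow k y).const_mul _).div_const _)
    (fun k y hy => by
      have hy' : |y| ≤ |R| := by
        rw [mem_ball_zero_iff, Real.norm_eq_abs] at hy
        exact hy.le.trans (le_abs_self R)
      simp only [g', norm_div, norm_mul, norm_pow, Real.norm_eq_abs]
      gcongr)
    hsR (by
      refine (summable_gamma_rpow_mul_pow_div_factorial hr1 hν (lam * s)).congr fun k => ?_
      rw [mul_pow, mul_assoc]) hsR
  have htsum := (hsum s).tsum_eq_zero_add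
  simp_rw [hsucc] at htsum
  rw [htsum] at key
  simpa [g'] using key

lemma image_mul_exp_neg_Ioi {t : ℝ} (ht : 0 < t) :
    (fun u : ℝ => t * Real.exp (-u)) '' Ioi 0 = Ioo 0 t := by
  ext τ
  constructor
  · rintro ⟨u, hu, rfl⟩
    have hu' : Real.exp (-u) < 1 := Real.exp_lt_one_iff.2 (by simpa using hu)
    exact ⟨by positivity, by nlinarith⟩
  · rintro ⟨h0, h1⟩
    refine ⟨Real.log (t / τ), Real.log_pos ((one_lt_div h0).2 h1), ?_⟩
    dsimp only
    rw [Real.exp_neg, Real.exp_log (by positivity)]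
    field_simp

/-- The Hadamard fractional integral of a power function. -/
lemma integral_log_rpow_mul_rpow {r p t : ℝ} (hr : 0 < r) (hp : 0 < p) (ht : 0 < t) :
    ∫ τ in Ioc 0 t, Real.log (t / τ) ^ (r - 1) * τ ^ (p - 1) =
      Real.Gamma r * (t ^ p / p ^ r) := by
  have hderiv (u : ℝ) (_ : u ∈ Ioi (0 : ℝ)) :
      HasDerivWithinAt (fun u : ℝ => t * Real.exp (-u)) (-(t * Real.exp (-u))) (Ioi 0) u := by
    have := ((hasDerivAt_neg u).exp.const_mul t).hasDerivWithinAt (s := Ioi 0)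
    simpa using this
  have hinj : InjOn (fun u : ℝ => t * Real.exp (-u)) (Ioi 0) := fun a _ b _ hab => by
    simpa [ht.ne'] using hab
  rw [integral_Ioc_eq_integral_Ioo, ← image_mul_exp_neg_Ioi ht,
    integral_image_eq_integral_abs_deriv_smul measurableSet_Ioi hderiv hinj]
  have hint := Real.integral_rpow_mul_exp_neg_mul_Ioi hr hp
  calc _ = ∫ u in Ioi (0 : ℝ), t ^ p * (u ^ (r - 1) * Real.exp (-(p * u))) := by
        refine setIntegral_congr_fun measurableSet_Ioi fun u _ => ?_
        have h1 : t / (t * Real.exp (-u)) = Real.exp u := by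
          rw [Real.exp_neg]; field_simp
        have h2 : 0 < t * Real.exp (-u) := by positivity
        have h3 : (t * Real.exp (-u)) ^ p = t ^ p * Real.exp (-(p * u)) := by
          rw [Real.mul_rpow ht.le (Real.exp_pos _).le, ← Real.exp_mul]
          ring_nf
        simp only [h1, Real.log_exp, abs_neg, abs_of_pos h2, smul_eq_mul,
          Real.rpow_sub_one h2.ne', h3]
        field_simp
    _ = _ := by
        rw [integral_const_mul, hint, Real.div_rpow zero_le_one hp.le, Real.one_rpow]
        ring

lemma integrableOn_log_rpow_mul_rpow {r p t : ℝ} (hr : 0 < r) (hp : 0 < p) (ht : 0 < t) :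
    IntegrableOn (fun τ => Real.log (t / τ) ^ (r - 1) * τ ^ (p - 1)) (Ioc 0 t) := by
  refine Integrable.of_integral_ne_zero ?_
  rw [integral_log_rpow_mul_rpow hr hp ht]
  have := Real.Gamma_pos_of_pos hr
  positivity

/-- For `r ∈ (0,1/2)`, `ν ∈ (0,1]`, `λ > 0`, `t > 0`, the normalizing function
`C(s) = ∑ (Γ(ν+k))^r λ^k s^k / k!` of the GCOM-Poisson distribution satisfies the
Hadamard-type integro-differential equation `𝒥^r (t^ν dC/dt) = λ t^ν C`:
`(1/Γ(r)) ∫_0^t (log(t/τ))^(r-1) τ^(ν-1) C'(τ) dτ = λ t^ν C(t)`. -/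
theorem gcomPoisson_hadamard_equation (r ν lam t : ℝ) (hr : r ∈ Set.Ioo (0:ℝ) (1/2))
    (hν : ν ∈ Set.Ioc (0:ℝ) 1) (hlam : 0 < lam) (ht : 0 < t) :
    (1 / Real.Gamma r) *
        ∫ τ in (0:ℝ)..t, Real.log (t / τ) ^ (r - 1) * τ ^ (ν - 1) *
          deriv (fun s : ℝ =>
            ∑' k : ℕ, Real.Gamma (ν + (k : ℝ)) ^ r * lam ^ k * s ^ k / (Nat.factorial k : ℝ)) τ
      = lam * t ^ ν *
        ∑' k : ℕ, Real.Gamma (ν + (k : ℝ)) ^ r * lam ^ k * t ^ k / (Nat.factorial k : ℝ) := by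
  obtain ⟨hr0, hr2⟩ := hr
  obtain ⟨hν0, -⟩ := hν
  have hr1 : r < 1 := by linarith
  have hν1 : 0 < ν + 1 := by linarith
  have hΓr := Real.Gamma_pos_of_pos hr0
  set a : ℕ → ℝ := fun k =>
    lam * (Real.Gamma (ν + 1 + k) ^ r * lam ^ k / (Nat.factorial k : ℝ))
  have ha (k : ℕ) : 0 ≤ a k := by
    have := Real.Gamma_pos_of_pos (s := ν + 1 + k) (by positivity)
    positivity
  set F : ℕ → ℝ → ℝ := fun k τ =>
    a k * (Real.log (t / τ) ^ (r - 1) * τ ^ (ν + k - 1))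
  have hF (k : ℕ) : ∫ τ in Ioc 0 t, F k τ = Real.Gamma r * (lam * t ^ ν *
      (Real.Gamma (ν + k) ^ r * lam ^ k * t ^ k / (Nat.factorial k : ℝ))) := by
    have hk : 0 < ν + k := by positivity
    have hG : Real.Gamma (ν + 1 + k) = (ν + k) * Real.Gamma (ν + k) := by
      rw [← Real.Gamma_add_one hk.ne']; ring_nf
    simp only [F, a]
    rw [integral_const_mul, integral_log_rpow_mul_rpow hr0 hk ht, hG,
      Real.mul_rpow hk.le (Real.Gamma_pos_of_pos hk).le, Real.rpow_add ht, Real.rpow_natCast]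
    have := Real.rpow_pos_of_pos hk r
    field_simp
  have hFint (k : ℕ) : Integrable (F k) (volume.restrict (Ioc 0 t)) :=
    (integrableOn_log_rpow_mul_rpow hr0 (by positivity) ht).const_mul _
  have hFnorm (k : ℕ) : ∫ τ in Ioc 0 t, ‖F k τ‖ = ∫ τ in Ioc 0 t, F k τ := by
    refine setIntegral_congr_fun measurableSet_Ioc fun τ hτ => ?_
    have hlog : 0 ≤ Real.log (t / τ) := Real.log_nonneg ((one_le_div hτ.1).2 hτ.2)
    exact Real.norm_of_nonneg (mul_nonneg (ha k)
      (mul_nonneg (Real.rpow_nonneg hlog _) (Real.rpow_nonneg hτ.1.le _)))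
  have hsum : Summable fun k => ∫ τ in Ioc 0 t, ‖F k τ‖ := by
    simp_rw [hFnorm, hF]
    refine Summable.mul_left _ (Summable.mul_left _ ?_)
    refine (summable_gamma_rpow_mul_pow_div_factorial hr1 hν0 (lam * t)).congr fun k => ?_
    rw [mul_pow, mul_assoc]
  have hcongr : ∫ τ in Ioc 0 t, Real.log (t / τ) ^ (r - 1) * τ ^ (ν - 1) *
      deriv (fun s : ℝ =>
        ∑' k : ℕ, Real.Gamma (ν + (k : ℝ)) ^ r * lam ^ k * s ^ k / (Nat.factorial k : ℝ)) τ =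
      ∫ τ in Ioc 0 t, ∑' k, F k τ := by
    refine setIntegral_congr_fun measurableSet_Ioc fun τ hτ => ?_
    rw [(hasDerivAt_tsum_gamma_rpow hr1 hν0 τ).deriv, ← tsum_mul_left]
    refine tsum_congr fun k => ?_
    simp only [F, a]
    rw [show ν + (k : ℝ) - 1 = ν - 1 + k by ring, Real.rpow_add hτ.1, Real.rpow_natCast, mul_pow]
    ring
  rw [intervalIntegral.integral_of_le ht.le, hcongr,
    ← integral_tsum_of_summable_integral_norm hFint hsum]
  simp_rw [hF, tsum_mul_left]
  field_simp
end

section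
/- Let f(t) = ∑_{k=0}^∞ t^{2k} / (2^k (k!)^2) (a series converging for every real t). Then for every real t, t · d/dt ( t · f′(t) ) = 2 t^2 f(t); that is, the function E_{2;1,1}(t^2/2) satisfies (t d/dt)^2 f = 2 t^2 f. -/
/-- The operator `t d/dt` acts termwise on an everywhere convergent even power series. -/
theorem mul_deriv_tsum_even_pow (a : ℕ → ℝ)
    (h : ∀ r : ℝ, Summable fun k : ℕ => 2 * (k : ℝ) * a k * r ^ (2 * k)) (t : ℝ) :
    t * deriv (fun u : ℝ => ∑' k : ℕ, a k * u ^ (2 * k)) t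
      = ∑' k : ℕ, 2 * (k : ℝ) * a k * t ^ (2 * k) := by
  have hR : (1 : ℝ) ≤ |t| + 1 := by linarith [abs_nonneg t]
  have hd : HasDerivAt (fun u : ℝ => ∑' k : ℕ, a k * u ^ (2 * k))
      (∑' k : ℕ, a k * (((2 * k : ℕ) : ℝ) * t ^ (2 * k - 1))) t := by
    refine hasDerivAt_tsum_of_isPreconnected (h (|t| + 1)).norm (t := Metric.ball 0 (|t| + 1))
      (y₀ := 0) Metric.isOpen_ball (convex_ball _ _).isPreconnected
      (fun k y _ => (hasDerivAt_pow (2 * k) y).const_mul (a k)) ?_ ?_ ?_ ?_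
    · intro k y hy
      rw [mem_ball_zero_iff] at hy
      have hy' : ‖y‖ ^ (2 * k - 1) ≤ (|t| + 1) ^ (2 * k) :=
        (pow_le_pow_left₀ (norm_nonneg y) hy.le _).trans
          (pow_le_pow_right₀ hR (Nat.sub_le _ _))
      have e : a k * (((2 * k : ℕ) : ℝ) * y ^ (2 * k - 1))
          = 2 * (k : ℝ) * a k * y ^ (2 * k - 1) := by
        push_cast; ring
      rw [e, norm_mul, norm_mul (2 * (k : ℝ) * a k), norm_pow, norm_pow,
        Real.norm_of_nonneg (by linarith : (0 : ℝ) ≤ |t| + 1)]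
      gcongr
    · simpa using (by linarith [abs_nonneg t] : (0 : ℝ) < |t| + 1)
    · refine summable_of_ne_finset_zero (s := {0}) fun k hk => ?_
      have : k ≠ 0 := by simpa using hk
      simp [this]
    · simp
  rw [hd.deriv, ← tsum_mul_left]
  refine tsum_congr fun k => ?_
  rcases k with _ | k
  · simp
  · rw [show 2 * (k + 1) - 1 = 2 * k + 1 by omega, show 2 * (k + 1) = 2 * k + 1 + 1 by ring]
    push_cast
    ring

theorem summable_sq_mul_pow_div_factorial_sq (r : ℝ) :
    Summable fun k : ℕ =>
      (2 * (k : ℝ)) ^ 2 * (r ^ (2 * k) / (2 ^ k * (Nat.factorial k : ℝ) ^ 2)) := by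
  refine Summable.of_nonneg_of_le (fun k => ?_) (fun k => ?_)
    ((Real.summable_pow_div_factorial (2 * r ^ 2)).mul_left 4)
  · rw [pow_mul]; positivity
  · have hf : (1 : ℝ) ≤ (Nat.factorial k : ℝ) := by exact_mod_cast k.factorial_pos
    have hk : (k : ℝ) ≤ 2 ^ k := by exact_mod_cast Nat.lt_two_pow_self.le
    rw [pow_mul, mul_pow 2 (r ^ 2)]
    calc (2 * (k : ℝ)) ^ 2 * ((r ^ 2) ^ k / (2 ^ k * (Nat.factorial k : ℝ) ^ 2))
        ≤ (2 * 2 ^ k) ^ 2 * ((r ^ 2) ^ k / (2 ^ k * (Nat.factorial k : ℝ) ^ 1)) := by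
          gcongr
          norm_num
      _ = 4 * (2 ^ k * (r ^ 2) ^ k / (Nat.factorial k : ℝ)) := by
          field_simp
          ring

/-- The function `f(t) = E_{2;1,1}(t^2/2) = ∑ t^(2k) / (2^k (k!)^2)` satisfies
`(t d/dt)^2 f = 2 t^2 f`, i.e. `t · d/dt (t · f'(t)) = 2 t^2 f(t)` for all real `t`. -/
theorem leRoy_two_hadamard_equation :
    ∀ t : ℝ,
      t * deriv (fun s : ℝ =>
          s * deriv (fun u : ℝ =>
            ∑' k : ℕ, u ^ (2 * k) / (2 ^ k * (Nat.factorial k : ℝ) ^ 2)) s) t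
        = 2 * t ^ 2 * ∑' k : ℕ, t ^ (2 * k) / (2 ^ k * (Nat.factorial k : ℝ) ^ 2) := by
  intro t
  set a : ℕ → ℝ := fun k => 1 / (2 ^ k * (Nat.factorial k : ℝ) ^ 2) with ha
  have hsum (u : ℝ) : ∑' k : ℕ, u ^ (2 * k) / (2 ^ k * (Nat.factorial k : ℝ) ^ 2)
      = ∑' k : ℕ, a k * u ^ (2 * k) :=
    tsum_congr fun k => by simp only [ha]; ring
  have h₂ (r : ℝ) : Summable fun k : ℕ => 2 * (k : ℝ) * (2 * (k : ℝ) * a k) * r ^ (2 * k) :=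
    (summable_sq_mul_pow_div_factorial_sq r).congr fun k => by simp only [ha]; ring
  have h₁ (r : ℝ) : Summable fun k : ℕ => 2 * (k : ℝ) * a k * r ^ (2 * k) := by
    refine Summable.of_norm_bounded (h₂ r).norm fun k => ?_
    rcases k with _ | k
    · simp
    · have hk : (1 : ℝ) ≤ ‖2 * ((k + 1 : ℕ) : ℝ)‖ := by
        rw [Real.norm_of_nonneg (by positivity)]
        push_cast
        linarith [(Nat.cast_nonneg k : (0 : ℝ) ≤ k)]
      rw [mul_assoc (2 * ((k + 1 : ℕ) : ℝ)) (2 * ((k + 1 : ℕ) : ℝ) * a (k + 1)),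
        norm_mul (2 * ((k + 1 : ℕ) : ℝ)) (_ * _)]
      exact le_mul_of_one_le_left (norm_nonneg _) hk
  simp only [hsum]
  simp only [mul_deriv_tsum_even_pow a h₁]
  rw [mul_deriv_tsum_even_pow _ h₂, (h₂ t).tsum_eq_zero_add, ← tsum_mul_left]
  simp only [Nat.cast_zero, mul_zero, zero_mul, zero_add]
  refine tsum_congr fun k => ?_
  simp only [ha, Nat.factorial_succ]
  push_cast
  have : (Nat.factorial k : ℝ) ≠ 0 := by positivity
  field_simp
  ring
end

section
/- Let α ≥ 1 and n ≥ 1 be integers and let f(t) = ∑_{k=0}^∞ t^{αnk} / (α^{nk} (k!)^{nα}) (a series converging for every real t). Then for every real t, (δ^{nα} f)(t) = α^{nα−n} n^{nα} t^{nα} f(t), where δ^{nα} denotes the (nα)-fold iterate of the operator δ sending a function g to t ↦ t·g′(t). Equivalently, f = E_{nα;1,1}(t^{αn}/α^n) solves the hyper-Bessel-type equation t^{−αn} (t d/dt)^α ⋯ (t d/dt)^α f = α^{nα−n} n^{nα} f (n factors). -/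
/-- If a generalized power series `∑ a k * x ^ e k` converges everywhere, then so does the series
obtained from it by applying `x d/dx` termwise. -/
theorem summable_exponent_mul_of_summable {a : ℕ → ℝ} {e : ℕ → ℕ}
    (h : ∀ x : ℝ, Summable fun k => a k * x ^ e k) (x : ℝ) :
    Summable fun k => (e k * a k) * x ^ e k := by
  refine Summable.of_norm_bounded (h (2 * x)).norm fun k => ?_
  have h2 : (e k : ℝ) ≤ 2 ^ e k := by exact_mod_cast (Nat.lt_two_pow_self).le
  simp only [norm_mul, norm_pow, mul_pow, RCLike.norm_natCast, Real.norm_ofNat]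
  calc (e k : ℝ) * ‖a k‖ * ‖x‖ ^ e k ≤ 2 ^ e k * ‖a k‖ * ‖x‖ ^ e k := by gcongr
    _ = ‖a k‖ * (2 ^ e k * ‖x‖ ^ e k) := by ring

/-- The operator `x d/dx` acts termwise on an everywhere convergent generalized power series. -/
theorem mul_deriv_tsum_mul_pow {a : ℕ → ℝ} {e : ℕ → ℕ}
    (h : ∀ x : ℝ, Summable fun k => a k * x ^ e k) (x : ℝ) :
    x * deriv (fun y : ℝ => ∑' k, a k * y ^ e k) x = ∑' k, (e k * a k) * x ^ e k := by
  have hd : HasDerivAt (fun y : ℝ => ∑' k, a k * y ^ e k)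
      (∑' k, a k * (e k * x ^ (e k - 1))) x := by
    refine hasDerivAt_tsum_of_isPreconnected
      (summable_exponent_mul_of_summable h (|x| + 1)).norm
      (Metric.isOpen_ball (x := (0 : ℝ)) (ε := |x| + 1)) (convex_ball _ _).isPreconnected
      (fun k y _ => (hasDerivAt_pow (e k) y).const_mul (a k)) (fun k y hy => ?_)
      (Metric.mem_ball_self (by positivity)) (h 0) (by simp)
    have hy' : ‖y‖ ≤ |x| + 1 := (mem_ball_zero_iff.mp hy).le
    have h1 : (1 : ℝ) ≤ |x| + 1 := by linarith [abs_nonneg x]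
    have hpow : ‖y‖ ^ (e k - 1) ≤ (|x| + 1) ^ e k :=
      (pow_le_pow_left₀ (norm_nonneg y) hy' _).trans (pow_le_pow_right₀ h1 (Nat.sub_le _ _))
    simp only [norm_mul, norm_pow, RCLike.norm_natCast]
    rw [Real.norm_of_nonneg (by positivity : (0 : ℝ) ≤ |x| + 1)]
    calc ‖a k‖ * (e k * ‖y‖ ^ (e k - 1)) ≤ ‖a k‖ * (e k * (|x| + 1) ^ e k) := by gcongr
      _ = e k * ‖a k‖ * (|x| + 1) ^ e k := by ring
  rw [hd.deriv, ← tsum_mul_left]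
  refine tsum_congr fun k => ?_
  rcases Nat.eq_zero_or_pos (e k) with h0 | h0
  · simp [h0]
  · rw [← mul_pow_sub_one h0.ne' x]
    ring

/-- The iterates of `x d/dx` act termwise on an everywhere convergent generalized power series. -/
theorem iterate_mul_deriv_tsum_mul_pow (m : ℕ) {a : ℕ → ℝ} {e : ℕ → ℕ}
    (h : ∀ x : ℝ, Summable fun k => a k * x ^ e k) :
    (fun g : ℝ → ℝ => fun x : ℝ => x * deriv g x)^[m] (fun x => ∑' k, a k * x ^ e k) =
      fun x => ∑' k, ((e k : ℝ) ^ m * a k) * x ^ e k := by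
  induction m generalizing a with
  | zero => simp
  | succ m ih =>
    rw [Function.iterate_succ_apply, funext (mul_deriv_tsum_mul_pow h),
      ih (summable_exponent_mul_of_summable h)]
    simp only [pow_succ, mul_assoc]

/-- The series defining `E_{nα;1,1}(x^(αn)/α^n)` converges for every real `x`. -/
theorem summable_leRoy {α n : ℕ} (hα : 1 ≤ α) (hn : 1 ≤ n) (x : ℝ) :
    Summable fun k : ℕ =>
      ((α : ℝ) ^ (n * k) * (Nat.factorial k : ℝ) ^ (n * α))⁻¹ * x ^ (α * n * k) := by
  refine Summable.of_norm_bounded (Real.summable_pow_div_factorial (|x| ^ (α * n))) fun k => ?_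
  have h1 : (1 : ℝ) ≤ (α : ℝ) ^ (n * k) := one_le_pow₀ (by exact_mod_cast hα)
  have hf : (1 : ℝ) ≤ Nat.factorial k := by exact_mod_cast Nat.factorial_pos k
  have h2 : (Nat.factorial k : ℝ) ≤ (Nat.factorial k : ℝ) ^ (n * α) :=
    le_self_pow₀ hf (Nat.mul_pos hn hα).ne'
  have h3 : (Nat.factorial k : ℝ) ≤ (α : ℝ) ^ (n * k) * (Nat.factorial k : ℝ) ^ (n * α) :=
    h2.trans (le_mul_of_one_le_left (by positivity) h1)
  rw [norm_mul, norm_inv, norm_pow, Real.norm_eq_abs x, Real.norm_of_nonneg (by positivity),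
    pow_mul |x|, div_eq_inv_mul]
  gcongr


/-- For integers `α ≥ 1` and `n ≥ 1`, the function
`f(t) = E_{nα;1,1}(t^(αn)/α^n) = ∑ t^(αnk) / (α^(nk) (k!)^(nα))` satisfies
`δ^[nα] f = α^(nα-n) n^(nα) t^(nα) f`, where `δ : g ↦ (t ↦ t·g'(t))`; i.e. `f`
solves the hyper-Bessel-type equation
`t^(-αn) (t d/dt)^α ⋯ (t d/dt)^α f = α^(nα-n) n^(nα) f` (`n` factors). -/
theorem leRoy_hyperBessel_equation (α n : ℕ) (hα : 1 ≤ α) (hn : 1 ≤ n) :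
    ∀ t : ℝ,
      ((fun g : ℝ → ℝ => fun x : ℝ => x * deriv g x)^[n * α]
        (fun x : ℝ =>
          ∑' k : ℕ, x ^ (α * n * k) / ((α : ℝ) ^ (n * k) * (Nat.factorial k : ℝ) ^ (n * α)))) t
      = (α : ℝ) ^ (n * α - n) * (n : ℝ) ^ (n * α) * t ^ (n * α) *
        ∑' k : ℕ, t ^ (α * n * k) / ((α : ℝ) ^ (n * k) * (Nat.factorial k : ℝ) ^ (n * α)) := by
  intro t
  have hα0 : (α : ℝ) ≠ 0 := by exact_mod_cast (by omega : α ≠ 0)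
  have hs := summable_leRoy hα hn
  simp only [div_eq_inv_mul]
  rw [iterate_mul_deriv_tsum_mul_pow (n * α) (e := fun k => α * n * k) hs]
  beta_reduce
  rw [← Nat.succ_injective.tsum_eq, ← tsum_mul_left]
  · refine tsum_congr fun k => ?_
    have hsplit : (α : ℝ) ^ (n * α) = α ^ (n * α - n) * α ^ n := by
      rw [← pow_add, Nat.sub_add_cancel (Nat.le_mul_of_pos_right n hα)]
    have hk : ((k : ℝ) + 1) ≠ 0 := by positivity
    rw [Nat.succ_eq_add_one, Nat.factorial_succ, mul_comm α n]
    push_cast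
    rw [mul_pow, mul_pow, mul_pow, hsplit]
    field_simp
    ring
  · intro k hk
    rcases k with _ | k
    · simp [(Nat.mul_pos hn hα).ne'] at hk
    · exact ⟨k, rfl⟩
end
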